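/- Suppose Δ = inf_j ‖μ_{j+1} − μ_j‖ > 0, consecutive change points are at distance at least δₙ = c₁·n^{1−ω} with 0 ≤ ω < 1/8, all means satisfy ‖μ_i‖ ≤ B, M_u − M_l = 0, conditions (s₂) and (s₃) hold, and v is a change point with l < v < u satisfying ‖Θ_{l,u}^v‖ > Θ_{l,u} − 2C₁·log^p(n), where Θ_{l,u} = max_{l<k<u} ‖Θ_{l,u}^k‖. Then there exist positive constants C_l and C_u, independent of n, such that C_l·δₙ/√n ≤ ‖Θ_{l,u}^v‖ ≤ C_u·n/√δₙ for all n sufficiently large. -/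

import Mathlib

open Filter MeasureTheory ProbabilityTheory

/-- Partial sum `S_k = ∑_{j=1}^k x_j`. -/
noncomputable def psum {H : Type*} [AddCommMonoid H] (x : ℕ → H) (k : ℕ) : H :=
  ∑ j ∈ Finset.Icc 1 k, x j

/-- The (generalized) CUSUM process of the sequence `x` on the segment `(l, u]`:
`𝒮_{l,u}^k = √((u−l)/((u−k)(k−l))) • [S_k − S_l − ((k−l)/(u−l)) (S_u − S_l)]`. -/
noncomputable def cusum {H : Type*} [NormedAddCommGroup H] [NormedSpace ℝ H]
    (x : ℕ → H) (l u k : ℕ) : H :=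
  Real.sqrt (((u : ℝ) - l) / (((u : ℝ) - k) * ((k : ℝ) - l))) •
    (psum x k - psum x l - (((k : ℝ) - l) / ((u : ℝ) - l)) • (psum x u - psum x l))

theorem psum_add_sum_Ioc {H : Type*} [AddCommMonoid H] (x : ℕ → H) {a b : ℕ} (hab : a ≤ b) :
    psum x a + ∑ j ∈ Finset.Ioc a b, x j = psum x b := by
  induction b, hab using Nat.le_induction with
  | base => simp
  | succ b hab ih =>
    rw [Finset.sum_Ioc_succ_top (by omega), ← add_assoc, ih, psum, psum,
      Finset.sum_Icc_succ_top (by omega)]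

theorem psum_sub_psum {H : Type*} [AddCommGroup H] (x : ℕ → H) {a b : ℕ} (hab : a ≤ b) :
    psum x b - psum x a = ∑ j ∈ Finset.Ioc a b, x j := by
  rw [← psum_add_sum_Ioc x hab, add_sub_cancel_left]

theorem norm_psum_sub_psum_le {H : Type*} [NormedAddCommGroup H] {x : ℕ → H} {a b : ℕ} {B : ℝ}
    (hab : a ≤ b) (hx : ∀ i, a < i → i ≤ b → ‖x i‖ ≤ B) :
    ‖psum x b - psum x a‖ ≤ ((b : ℝ) - a) * B := by
  rw [psum_sub_psum x hab]
  refine (norm_sum_le_of_le _ fun i hi => ?_).trans_eq (b := ∑ _j ∈ Finset.Ioc a b, B) ?_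
  · exact hx i (Finset.mem_Ioc.1 hi).1 (Finset.mem_Ioc.1 hi).2
  · simp [Nat.cast_sub hab]

theorem psum_sub_psum_of_const {H : Type*} [NormedAddCommGroup H] [NormedSpace ℝ H] {x : ℕ → H}
    {a b : ℕ} {c : H} (hab : a ≤ b) (hx : ∀ i, a < i → i ≤ b → x i = c) :
    psum x b - psum x a = ((b : ℝ) - a) • c := by
  rw [psum_sub_psum x hab, Finset.sum_congr rfl fun i hi =>
    hx i (Finset.mem_Ioc.1 hi).1 (Finset.mem_Ioc.1 hi).2]
  simp [← Nat.cast_smul_eq_nsmul ℝ, Nat.cast_sub hab]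

section Cusum

variable {H : Type*} [NormedAddCommGroup H] [NormedSpace ℝ H] {x : ℕ → H} {l u k n : ℕ}

theorem norm_cusum_of_psum_eq (h : psum x u = psum x l) :
    ‖cusum x l u k‖ =
      Real.sqrt (((u : ℝ) - l) / (((u : ℝ) - k) * ((k : ℝ) - l))) * ‖psum x k - psum x l‖ := by
  rw [cusum, h, sub_self, smul_zero, sub_zero, norm_smul, Real.norm_of_nonneg (Real.sqrt_nonneg _)]

theorem norm_cusum_le {B : ℝ} (hB : 0 ≤ B) (h : psum x u = psum x l) (hl : l < k) (hu : k < u)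
    (hx : ∀ i, l < i → i ≤ u → ‖x i‖ ≤ B) :
    ‖cusum x l u k‖ ≤ B * Real.sqrt ((u : ℝ) - l) := by
  have h1 := norm_psum_sub_psum_le hl.le fun i hi hi' => hx i hi (hi'.trans hu.le)
  have h2 := norm_psum_sub_psum_le hu.le fun i hi hi' => hx i (hl.trans hi) hi'
  rw [h, norm_sub_rev] at h2
  have hl' : (0 : ℝ) < (k : ℝ) - l := sub_pos.2 (Nat.cast_lt.2 hl)
  have hu' : (0 : ℝ) < (u : ℝ) - k := sub_pos.2 (Nat.cast_lt.2 hu)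
  have hul : (0 : ℝ) < (u : ℝ) - l := by linarith
  rw [norm_cusum_of_psum_eq h, ← abs_of_nonneg (norm_nonneg (psum x k - psum x l)),
    ← Real.sqrt_sq_eq_abs, ← Real.sqrt_mul (by positivity)]
  refine Real.sqrt_le_iff.2 ⟨by positivity, ?_⟩
  rw [mul_pow, Real.sq_sqrt hul.le, div_mul_eq_mul_div, div_le_iff₀ (by positivity)]
  have h3 : ‖psum x k - psum x l‖ ^ 2 ≤ (((k : ℝ) - l) * B) * (((u : ℝ) - k) * B) := by
    rw [sq]
    exact mul_le_mul h1 h2 (norm_nonneg _) (by positivity)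
  calc _ ≤ ((u : ℝ) - l) * ((((k : ℝ) - l) * B) * (((u : ℝ) - k) * B)) := by gcongr
    _ = _ := by ring

theorem norm_psum_sub_psum_div_sqrt_le_norm_cusum (h : psum x u = psum x l) (hl : l < k)
    (hu : k < u) (hun : u ≤ n) :
    ‖psum x k - psum x l‖ / Real.sqrt n ≤ ‖cusum x l u k‖ := by
  have hl' : (0 : ℝ) < (k : ℝ) - l := sub_pos.2 (Nat.cast_lt.2 hl)
  have hu' : (0 : ℝ) < (u : ℝ) - k := sub_pos.2 (Nat.cast_lt.2 hu)
  have hun' : (u : ℝ) ≤ n := Nat.cast_le.2 hun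
  have hn : (0 : ℝ) < n := by linarith [(Nat.cast_nonneg k : (0 : ℝ) ≤ k)]
  rw [norm_cusum_of_psum_eq h, div_eq_inv_mul, ← Real.sqrt_inv]
  gcongr
  rw [inv_eq_one_div, div_le_div_iff₀ hn (by positivity)]
  have : (u : ℝ) - k ≤ n := by linarith [(Nat.cast_nonneg k : (0 : ℝ) ≤ k)]
  calc 1 * (((u : ℝ) - k) * ((k : ℝ) - l)) ≤ n * ((u : ℝ) - l) := by
        rw [one_mul]; gcongr
    _ = _ := mul_comm _ _

/-- Around a jump of the mean from `a` to `b` at `w`, the partial sums cannot all be small. -/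
theorem exists_norm_psum_sub_psum_ge_of_jump {w d : ℕ} {a b : H} (hd : d ≤ w)
    (ha : ∀ i, w - d < i → i ≤ w → x i = a) (hb : ∀ i, w < i → i ≤ w + d → x i = b) (z : H) :
    ∃ k, w - d ≤ k ∧ k ≤ w + d ∧ (d : ℝ) * ‖b - a‖ / 4 ≤ ‖psum x k - z‖ := by
  by_contra! hcon
  have h1 := hcon (w - d) le_rfl (by omega)
  have h2 := hcon w (by omega) (by omega)
  have h3 := hcon (w + d) (by omega) le_rfl
  have ea := psum_sub_psum_of_const (Nat.sub_le w d) ha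
  have eb := psum_sub_psum_of_const (Nat.le_add_right w d) hb
  have e : (d : ℝ) • (b - a) =
      (psum x (w + d) - z) - (psum x w - z) - ((psum x w - z) - (psum x (w - d) - z)) := by
    rw [sub_sub_sub_cancel_right, sub_sub_sub_cancel_right, ea, eb, Nat.cast_sub hd, smul_sub]
    congr 2 <;> push_cast <;> ring
  have hnorm := congrArg norm e
  rw [norm_smul, Real.norm_natCast] at hnorm
  have t1 := norm_sub_le ((psum x (w + d) - z) - (psum x w - z))
    ((psum x w - z) - (psum x (w - d) - z))
  have t2 := norm_sub_le (psum x (w + d) - z) (psum x w - z)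
  have t3 := norm_sub_le (psum x w - z) (psum x (w - d) - z)
  linarith

end Cusum

theorem exists_lt_le_succ_of_le {v : ℕ → ℕ} {i : ℕ} (h0 : v 0 < i) :
    ∀ m, i ≤ v (m + 1) → ∃ j ≤ m, v j < i ∧ i ≤ v (j + 1)
  | 0, h => ⟨0, le_rfl, h0, h⟩
  | m + 1, h => by
    by_cases hm : i ≤ v (m + 1)
    · obtain ⟨j, hj, hj'⟩ := exists_lt_le_succ_of_le h0 m hm
      exact ⟨j, hj.trans m.le_succ, hj'⟩
    · exact ⟨m + 1, le_rfl, not_le.1 hm, h⟩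

theorem eventually_log_rpow_le_mul_spacing_div_sqrt {ω c₁ : ℝ} (hω : ω < 1 / 2) (hc₁ : 0 < c₁)
    (p : ℝ) {C K : ℝ} (hC : 0 < C) (hK : 0 < K) :
    ∀ᶠ n : ℕ in atTop,
      C * Real.log n ^ p ≤ K * (c₁ * (n : ℝ) ^ (1 - ω) / Real.sqrt n) := by
  have h := (isLittleO_log_rpow_rpow_atTop p (sub_pos.2 hω)).comp_tendsto
    (tendsto_natCast_atTop_atTop (R := ℝ))
  filter_upwards [h.bound (show 0 < K * c₁ / C by positivity), eventually_ge_atTop 1] with n hn h1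
  have hn0 : (0 : ℝ) < n := by exact_mod_cast h1
  simp only [Function.comp_apply, Real.norm_eq_abs] at hn
  rw [abs_of_nonneg (Real.rpow_nonneg hn0.le _)] at hn
  have e : (n : ℝ) ^ (1 - ω) / Real.sqrt n = (n : ℝ) ^ (1 / 2 - ω) := by
    rw [Real.sqrt_eq_rpow, ← Real.rpow_sub hn0]
    congr 1
    ring
  calc C * Real.log n ^ p ≤ C * (K * c₁ / C * (n : ℝ) ^ (1 / 2 - ω)) := by
        gcongr
        exact (le_abs_self _).trans hn
    _ = K * (c₁ * (n : ℝ) ^ (1 - ω) / Real.sqrt n) := by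
        rw [mul_div_assoc c₁, e]
        field_simp

theorem sqrt_le_mul_div_sqrt_spacing {ω c₁ : ℝ} (hω0 : 0 ≤ ω) (hc₁ : 0 < c₁) {n : ℕ} (hn : 1 ≤ n) :
    Real.sqrt n ≤ Real.sqrt c₁ * ((n : ℝ) / Real.sqrt (c₁ * (n : ℝ) ^ (1 - ω))) := by
  have hn1 : (1 : ℝ) ≤ n := by exact_mod_cast hn
  have hn0 : (0 : ℝ) < n := by linarith
  rw [← mul_div_assoc, le_div_iff₀ (by positivity)]
  have h : (n : ℝ) ^ (1 - ω) ≤ n := by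
    simpa using Real.rpow_le_rpow_of_exponent_le hn1 (show 1 - ω ≤ 1 by linarith)
  calc Real.sqrt n * Real.sqrt (c₁ * (n : ℝ) ^ (1 - ω))
      ≤ Real.sqrt n * Real.sqrt (c₁ * n) := by gcongr
    _ = Real.sqrt c₁ * n := by
      rw [Real.sqrt_mul hc₁.le, mul_left_comm, Real.mul_self_sqrt hn0.le]

/-- Lemma 4 of the paper: under the change point model with minimal jump `Δ > 0`, minimal spacing
`δₙ = c₁ n^{1−ω}` (`0 ≤ ω < 1/8`), means bounded by `B`, `M_u − M_l = 0`, conditions (s₂) and (s₃),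
if a change point `v` with `l < v < u` satisfies `‖Θ_{l,u}^v‖ > Θ_{l,u} − 2C₁ log^p n`, then
`C_l δₙ/√n ≤ ‖Θ_{l,u}^v‖ ≤ C_u n/√δₙ` with constants `C_l, C_u` independent of `n`,
for all `n` sufficiently large. -/
theorem signal_cusum_at_near_max_change_point_bounds
    {H : Type*} [NormedAddCommGroup H] [InnerProductSpace ℝ H]
    (Δ B c₁ ω C₁ p : ℝ)
    (hΔ : 0 < Δ) (hB : 0 < B) (hc₁ : 0 < c₁) (hω0 : 0 ≤ ω) (hω : ω < 1 / 8)
    (hC₁ : 0 < C₁) (hp : 1 < p) :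
    ∃ Cl Cu : ℝ, 0 < Cl ∧ 0 < Cu ∧ ∃ N : ℕ, ∀ n : ℕ, N ≤ n →
      ∀ (m i₀ β l u vcp : ℕ) (v : ℕ → ℕ) (μs um : ℕ → H) (ξ : ℝ),
        -- change point model on the whole sample
        v 0 = 0 → n ≤ v (m + 1) →
        (∀ j, j ≤ m → ∀ i, v j < i → i ≤ v (j + 1) → um i = μs (j + 1)) →
        (∀ j, 1 ≤ j → j ≤ m → Δ ≤ ‖μs (j + 1) - μs j‖) →
        (∀ j, 1 ≤ j → j ≤ m + 1 → ‖μs j‖ ≤ B) →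
        (∀ j, j ≤ m → c₁ * (n : ℝ) ^ (1 - ω) ≤ (v (j + 1) : ℝ) - (v j : ℝ)) →
        -- the segment `(l, u]`, with `β` change points `v_{i₀+1} < … < v_{i₀+β}` inside
        i₀ + β ≤ m → v i₀ ≤ l → l < v (i₀ + 1) → v (i₀ + β) < u → u ≤ v (i₀ + β + 1) → u ≤ n →
        -- `M_u − M_l = 0`
        psum um u = psum um l →
        -- condition (s₂)
        1 / 2 ≤ ξ → ξ < 1 →
        (∃ r, 1 ≤ r ∧ r ≤ β ∧
          (l : ℝ) < (v (i₀ + r) : ℝ) - ξ * (c₁ * (n : ℝ) ^ (1 - ω)) ∧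
          (v (i₀ + r) : ℝ) + ξ * (c₁ * (n : ℝ) ^ (1 - ω)) < (u : ℝ)) →
        -- condition (s₃)
        max ((min (v (i₀ + 1) - l) (l - v i₀) : ℕ) : ℝ)
            ((min (u - v (i₀ + β)) (v (i₀ + β + 1) - u) : ℕ) : ℝ) ≤
          (n : ℝ) ^ ((5 : ℝ) / 8 + ω) * Real.log n →
        -- `vcp` is a change point with `l < vcp < u`
        (∃ j, 1 ≤ j ∧ j ≤ β ∧ vcp = v (i₀ + j)) → l < vcp → vcp < u →
        -- `‖Θ_{l,u}^{vcp}‖ > Θ_{l,u} − 2C₁ log^p n`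
        (∀ k, l < k → k < u →
          ‖cusum um l u k‖ - 2 * C₁ * Real.log n ^ p < ‖cusum um l u vcp‖) →
        Cl * (c₁ * (n : ℝ) ^ (1 - ω) / Real.sqrt n) ≤ ‖cusum um l u vcp‖ ∧
          ‖cusum um l u vcp‖ ≤ Cu * ((n : ℝ) / Real.sqrt (c₁ * (n : ℝ) ^ (1 - ω))) := by
  refine ⟨Δ / 32, B * Real.sqrt c₁, by positivity, by positivity, ?_⟩
  have hlog := eventually_log_rpow_le_mul_spacing_div_sqrt (by linarith : ω < 1 / 2) hc₁ p
    (show 0 < 2 * C₁ by positivity) (show 0 < Δ / 32 by positivity)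
  have hlarge : ∀ᶠ n : ℕ in atTop, 4 ≤ c₁ * (n : ℝ) ^ (1 - ω) :=
    (((tendsto_rpow_atTop (by linarith : 0 < 1 - ω)).const_mul_atTop hc₁).comp
      tendsto_natCast_atTop_atTop).eventually_ge_atTop 4
  obtain ⟨N, hN⟩ := eventually_atTop.1 (hlog.and (hlarge.and (eventually_ge_atTop 1)))
  refine ⟨N, fun n hn m i₀ β l u vcp v μs um ξ hv0 hvn hum hjump hbd hsp hi₀ _ _ _ _ hun hM hξ _
    ⟨r, hr1, hrβ, hrl, hru⟩ _ _ hlv hvu hmax => ?_⟩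
  obtain ⟨hlogn, hδ4, hn1⟩ := hN n hn
  set δ := c₁ * (n : ℝ) ^ (1 - ω)
  constructor
  · obtain ⟨q, hq⟩ : ∃ q, i₀ + r = q + 1 := ⟨i₀ + r - 1, by omega⟩
    rw [hq] at hrl hru
    have hqm : q + 1 ≤ m := by omega
    set d := ⌊δ / 2⌋₊
    have hd_le : (d : ℝ) ≤ δ / 2 := Nat.floor_le (by linarith)
    have hd_ge : δ / 4 ≤ d := by linarith [Nat.lt_floor_add_one (δ / 2)]
    have hξδ : δ / 2 ≤ ξ * δ := by nlinarith
    have hsp1 := hsp q (by omega)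
    have hsp2 := hsp (q + 1) hqm
    have hd1 : v q + d ≤ v (q + 1) := by
      have : (v q : ℝ) + d ≤ v (q + 1) := by linarith
      exact_mod_cast this
    have hd2 : v (q + 1) + d ≤ v (q + 1 + 1) := by
      have : (v (q + 1) : ℝ) + d ≤ v (q + 1 + 1) := by linarith
      exact_mod_cast this
    have hld : l + d < v (q + 1) := by
      have : (l : ℝ) + d < v (q + 1) := by linarith
      exact_mod_cast this
    have hdu : v (q + 1) + d < u := by
      have : (v (q + 1) : ℝ) + d < u := by linarith
      exact_mod_cast this
    obtain ⟨k, hk1, hk2, hk⟩ := exists_norm_psum_sub_psum_ge_of_jump (x := um)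
      (w := v (q + 1)) (d := d) (by omega)
      (fun i hi hi' => hum q (by omega) i (by omega) hi')
      (fun i hi hi' => hum (q + 1) hqm i hi (by omega)) (psum um l)
    have hlk : l < k := by omega
    have hku : k < u := by omega
    have h1 := norm_psum_sub_psum_div_sqrt_le_norm_cusum hM hlk hku hun
    have h2 := hmax k hlk hku
    have h3 : Δ / 16 * δ ≤ ‖psum um k - psum um l‖ := by
      refine le_trans ?_ hk
      have := mul_le_mul hd_ge (hjump (q + 1) (by omega) hqm) hΔ.le (Nat.cast_nonneg d)
      linarith
    have h4 : Δ / 16 * (δ / Real.sqrt n) ≤ ‖psum um k - psum um l‖ / Real.sqrt n := by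
      rw [← mul_div_assoc]
      gcongr
    linarith
  · have hx : ∀ i, l < i → i ≤ u → ‖um i‖ ≤ B := fun i hli hiu => by
      obtain ⟨j, hj, hj1, hj2⟩ := exists_lt_le_succ_of_le (v := v) (i := i) (by omega) m (by omega)
      rw [hum j hj i hj1 hj2]
      exact hbd (j + 1) (by omega) (by omega)
    have hun' : (u : ℝ) - l ≤ n := by
      have : (u : ℝ) ≤ n := Nat.cast_le.2 hun
      linarith [(Nat.cast_nonneg l : (0 : ℝ) ≤ l)]
    calc ‖cusum um l u vcp‖ ≤ B * Real.sqrt ((u : ℝ) - l) := norm_cusum_le hB.le hM hlv hvu hx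
      _ ≤ B * Real.sqrt n := by gcongr
      _ ≤ B * (Real.sqrt c₁ * ((n : ℝ) / Real.sqrt δ)) := by
        gcongr
        exact sqrt_le_mul_div_sqrt_spacing hω0 hc₁ hn1
      _ = _ := by ring
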